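/- The number of weakly increasing parking functions of length n with largest index i such that x'_i = i equal to a fixed value i ∈ {1,...,n} is C_{i-1} · C_{n-i}, where C_k denotes the k-th Catalan number. -/

import Mathlib

/-- `x : Fin n → ℕ` is a parking function of length `n`: entries lie in `{1,...,n}` and
for every `k ∈ {1,...,n}`, at least `k` entries are `≤ k`. -/
def IsParkingFunction (n : ℕ) (x : Fin n → ℕ) : Prop :=
  (∀ i, 1 ≤ x i ∧ x i ≤ n) ∧
  ∀ k, 1 ≤ k → k ≤ n → k ≤ (Finset.univ.filter (fun i => x i ≤ k)).card

/-- Zero-indexed weakly increasing sequences below the diagonal. -/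
def DiagSeq (n : ℕ) : Type := {y : Fin n → ℕ // Monotone y ∧ ∀ j, y j ≤ (j : ℕ)}

/-- Those whose last touching of the diagonal is at the index `a`. -/
def LastDiag (n a : ℕ) (y : Fin n → ℕ) : Prop :=
  ∀ j : Fin n, ((j : ℕ) = a → y j = a) ∧ (a < (j : ℕ) → y j < (j : ℕ))

instance diagSeq_finite (n : ℕ) : Finite (DiagSeq n) := by
  refine Finite.of_injective (β := Fin n → Fin n)
    (fun y j => ⟨y.1 j, lt_of_le_of_lt (y.2.2 j) j.2⟩) ?_
  intro y z h
  apply Subtype.ext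
  funext j
  have := congrFun h j
  simpa using this

/-- Splitting at the last touching of the diagonal. -/
def splitEquiv (n a b : ℕ) (h : a + 1 + b = n) :
    {y : DiagSeq n // LastDiag n a y.1} ≃ DiagSeq a × DiagSeq b where
  toFun y :=
    (⟨fun j => y.1.1 ⟨j, by omega⟩,
      fun j k hjk => y.1.2.1 (by simpa using hjk), fun j => y.1.2.2 _⟩,
     ⟨fun k => y.1.1 ⟨a + 1 + k, by omega⟩ - a,
      fun j k hjk => Nat.sub_le_sub_right (y.1.2.1 (by simpa using hjk)) _,
      fun k => by
        have := (y.2 ⟨a + 1 + k, by omega⟩).2 (by simp; omega)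
        simp only at this
        dsimp only
        omega⟩)
  invFun p :=
    ⟨⟨fun j => if h1 : (j : ℕ) < a then p.1.1 ⟨j, h1⟩ else
        if h2 : (j : ℕ) = a then a else p.2.1 ⟨j - (a + 1), by omega⟩ + a, by
        intro j k hjk
        have hjk' : (j : ℕ) ≤ k := hjk
        dsimp only
        split_ifs with h1 h2 h3 h4 h5 h6
        all_goals try omega
        · exact p.1.2.1 (by simpa using hjk)
        · have := p.1.2.2 ⟨j, h1⟩
          simp only at this
          omega
        · have := p.1.2.2 ⟨j, h1⟩
          simp only at this
          omega
        · apply Nat.add_le_add_right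
          apply p.2.2.1
          simp only [Fin.mk_le_mk]
          omega, by
        intro j
        dsimp only
        split_ifs with h1 h2
        · exact p.1.2.2 ⟨j, h1⟩
        · omega
        · have := p.2.2.2 ⟨j - (a + 1), by omega⟩
          simp only at this
          omega⟩, by
      intro j
      constructor
      · intro hj
        simp [hj]
      · intro hj
        have := p.2.2.2 ⟨j - (a + 1), by omega⟩
        simp only at this
        dsimp only
        rw [dif_neg (by omega), dif_neg (by omega)]
        omega⟩
  left_inv y := by
    apply Subtype.ext
    apply Subtype.ext
    funext j
    dsimp only
    split_ifs with h1 h2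
    · rfl
    · exact ((y.2 j).1 h2).symm
    · have e : (⟨a + 1 + (j - (a + 1)), by omega⟩ : Fin n) = j := by
        apply Fin.ext
        simp only
        omega
      rw [e]
      have h3 := y.1.2.1 (show (⟨a, by omega⟩ : Fin n) ≤ j by
        show a ≤ (j : ℕ)
        omega)
      rw [(y.2 ⟨a, by omega⟩).1 rfl] at h3
      omega
  right_inv p := by
    apply Prod.ext
    · apply Subtype.ext
      funext j
      simp
    · apply Subtype.ext
      funext j
      dsimp only
      rw [dif_neg (by omega), dif_neg (by omega)]
      simp

lemma exists_lastDiag (n : ℕ) (y : DiagSeq (n + 1)) :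
    ∃! a : Fin (n + 1), LastDiag (n + 1) a y.1 := by
  classical
  have hne : (Finset.univ.filter (fun j : Fin (n + 1) => y.1 j = (j : ℕ))).Nonempty := by
    refine ⟨0, ?_⟩
    have := y.2.2 0
    simpa using this
  obtain ⟨a, ha, hmax⟩ := Finset.exists_max_image _ (fun j => j) hne
  simp only [Finset.mem_filter, Finset.mem_univ, true_and] at ha hmax
  refine ⟨a, ?_, ?_⟩
  · intro j
    constructor
    · intro hj
      rw [Fin.ext hj, ha]
    · intro hj
      refine lt_of_le_of_ne (y.2.2 j) (fun he => ?_)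
      have : (j : ℕ) ≤ a := hmax j he
      omega
  · intro c hc
    have hle : (c : ℕ) ≤ a := hmax c ((hc c).1 rfl)
    apply Fin.ext
    by_contra hne
    have := (hc a).2 (by omega)
    omega

lemma card_diagSeq (n : ℕ) : Nat.card (DiagSeq n) = catalan n := by
  induction n using Nat.strong_induction_on with
  | _ n ih =>
    cases n with
    | zero =>
      rw [catalan_zero, Nat.card_eq_one_iff_unique]
      refine ⟨⟨fun y z => Subtype.ext (funext fun j => j.elim0)⟩,
        ⟨⟨fun j => j.elim0, fun j => j.elim0, fun j => j.elim0⟩⟩⟩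
    | succ n =>
      choose f hf hu using exists_lastDiag n
      rw [catalan_succ, ← Nat.card_congr (Equiv.sigmaFiberEquiv f), Nat.card_sigma]
      refine Finset.sum_congr rfl fun a _ => ?_
      have e : {y : DiagSeq (n + 1) // f y = a} ≃
          {y : DiagSeq (n + 1) // LastDiag (n + 1) a y.1} :=
        Equiv.subtypeEquivRight fun y =>
          ⟨fun h => h ▸ hf y, fun h => (hu y a h).symm⟩
      rw [Nat.card_congr (e.trans (splitEquiv (n + 1) a (n - a) (by omega))), Nat.card_prod,
        ih a a.2, ih (n - a) (by omega)]

lemma monotone_pf_iff (n : ℕ) (x : Fin n → ℕ) (hx : Monotone x) :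
    IsParkingFunction n x ↔ ∀ j, 1 ≤ x j ∧ x j ≤ (j : ℕ) + 1 := by
  constructor
  · rintro ⟨h1, h2⟩ j
    refine ⟨(h1 j).1, ?_⟩
    by_contra hlt
    have h3 := h2 (j + 1) (by omega) (by omega)
    have h4 : Finset.univ.filter (fun i => x i ≤ (j : ℕ) + 1) ⊆ Finset.Iio j := by
      intro i hi
      simp only [Finset.mem_filter, Finset.mem_univ, true_and] at hi
      rw [Finset.mem_Iio]
      by_contra hij
      have := hx (not_lt.mp hij)
      omega
    have h5 := Finset.card_le_card h4
    rw [Fin.card_Iio] at h5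
    omega
  · intro h
    refine ⟨fun j => ⟨(h j).1, by have := (h j).2; omega⟩, fun k _ hk => ?_⟩
    have h4 : (Finset.univ : Finset (Fin k)).map (Fin.castLEEmb hk) ⊆
        Finset.univ.filter (fun i => x i ≤ k) := by
      intro i hi
      simp only [Finset.mem_map, Finset.mem_univ, true_and] at hi
      obtain ⟨c, rfl⟩ := hi
      simp only [Finset.mem_filter, Finset.mem_univ, true_and]
      have := (h (Fin.castLEEmb hk c)).2
      have h6 : ((Fin.castLEEmb hk c : Fin n) : ℕ) = c := rfl
      omega
    simpa using Finset.card_le_card h4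

/-- The number of weakly increasing parking functions of length `n` whose largest index
`i` with `x'_i = i` (1-indexed) equals a fixed `i ∈ {1,...,n}` is `C_{i-1} · C_{n-i}`. -/
theorem card_monotone_pf_with_fixed_last_diag (n i : ℕ) (h1 : 1 ≤ i) (h2 : i ≤ n) :
    Nat.card {x : Fin n → ℕ // IsParkingFunction n x ∧ Monotone x ∧
        x ⟨i - 1, by omega⟩ = i ∧
        ∀ j : Fin n, i < (j : ℕ) + 1 → x j ≠ (j : ℕ) + 1} =
      catalan (i - 1) * catalan (n - i) := by
  rw [← card_diagSeq, ← card_diagSeq, ← Nat.card_prod,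
    ← Nat.card_congr (splitEquiv n (i - 1) (n - i) (by omega))]
  symm
  refine Nat.card_congr (Equiv.ofBijective (fun y => ⟨fun j => y.1.1 j + 1, ?_⟩) ⟨?_, ?_⟩)
  · have hm : Monotone (fun j => y.1.1 j + 1) :=
      fun j k hjk => Nat.add_le_add_right (y.1.2.1 hjk) 1
    refine ⟨(monotone_pf_iff n _ hm).2 fun j => ⟨by omega, ?_⟩, hm, ?_, ?_⟩
    · have := y.1.2.2 j
      omega
    · have := (y.2 ⟨i - 1, by omega⟩).1 rfl
      dsimp only
      omega
    · intro j hj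
      have := (y.2 j).2 (by omega)
      dsimp only
      omega
  · intro y z hyz
    apply Subtype.ext
    apply Subtype.ext
    funext j
    have := congrFun (congrArg Subtype.val hyz) j
    simpa using this
  · rintro ⟨x, hp, hm, hi, hj⟩
    rw [monotone_pf_iff n x hm] at hp
    refine ⟨⟨⟨fun j => x j - 1, fun j k hjk => Nat.sub_le_sub_right (hm hjk) 1, ?_⟩, ?_⟩, ?_⟩
    · intro j
      have := hp j
      dsimp only
      omega
    · intro j
      constructor
      · intro h
        have e : j = ⟨i - 1, by omega⟩ := Fin.ext h
        dsimp only
        rw [e, hi]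
      · intro h
        have := hj j (by omega)
        have := hp j
        dsimp only
        omega
    · apply Subtype.ext
      funext j
      have := hp j
      dsimp only
      omega
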